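/- Let a ≤ b and c ≤ e be integers. Suppose given Young diagrams β_j for c ≤ j ≤ e with β_{j+1} obtained from β_j by adding one box for each c ≤ j < e, and Young diagrams α_i for a ≤ i ≤ b with α_{i−1} obtained from α_i by adding one box for each a < i ≤ b, such that α_b = β_e. Then there exists exactly one growth diagram γ on [a,b]×[c,e] with γ(b,j) = β_j for all c ≤ j ≤ e and γ(i,e) = α_i for all a ≤ i ≤ b. -/

import Mathlib

/-- `ν` is obtained from `μ` by adding one box. -/
def AddBox (μ ν : YoungDiagram) : Prop := μ ≤ ν ∧ ν.card = μ.card + 1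

/-- Two cells of `ℕ × ℕ` are adjacent: `|a−a'| + |b−b'| = 1`. -/
def CellAdj (c c' : ℕ × ℕ) : Prop :=
  |(c.1 : ℤ) - (c'.1 : ℤ)| + |(c.2 : ℤ) - (c'.2 : ℤ)| = 1

/-- A growth diagram on the rectangle `[a,b] × [c,e]`: a map `γ` on the rectangle
(normalized to `⊥` off it) into Young diagrams with `γ i (j+1)` and `γ (i−1) j`
obtained from `γ i j` by adding one box, and such that whenever the two cells of
`γ (i−1) (j+1) \ γ i j` are nonadjacent, `γ i (j+1) ≠ γ (i−1) j`. -/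
structure GrowthDiagram (a b c e : ℤ) where
  γ : ℤ → ℤ → YoungDiagram
  junk : ∀ i j : ℤ, ¬ (a ≤ i ∧ i ≤ b ∧ c ≤ j ∧ j ≤ e) → γ i j = ⊥
  grow_right : ∀ i j : ℤ, a ≤ i → i ≤ b → c ≤ j → j + 1 ≤ e →
    AddBox (γ i j) (γ i (j + 1))
  grow_up : ∀ i j : ℤ, a ≤ i - 1 → i ≤ b → c ≤ j → j ≤ e →
    AddBox (γ i j) (γ (i - 1) j)
  nonadj : ∀ i j : ℤ, a ≤ i - 1 → i ≤ b → c ≤ j → j + 1 ≤ e →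
    (∃ c₁ ∈ (γ (i - 1) (j + 1)).cells \ (γ i j).cells,
      ∃ c₂ ∈ (γ (i - 1) (j + 1)).cells \ (γ i j).cells, c₁ ≠ c₂ ∧ ¬ CellAdj c₁ c₂) →
    γ i (j + 1) ≠ γ (i - 1) j

theorem addBox_iff_exists_insert {μ ν : YoungDiagram} :
    AddBox μ ν ↔ ∃ x ∉ μ.cells, insert x μ.cells = ν.cells := by
  rw [Finset.exists_eq_insert_iff]
  exact and_congr Iff.rfl eq_comm

theorem CellAdj.symm {x y : ℕ × ℕ} (h : CellAdj x y) : CellAdj y x := by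
  unfold CellAdj at *
  rwa [abs_sub_comm, abs_sub_comm (y.2 : ℤ)]

theorem CellAdj.le_or_le {x y : ℕ × ℕ} (h : CellAdj x y) : x ≤ y ∨ y ≤ x := by
  simp only [CellAdj, abs_eq_max_neg] at h
  simp only [Prod.le_def]
  omega

/-- Comparable distinct cells are adjacent unless another cell lies between them. -/
theorem exists_between_of_not_cellAdj {x y : ℕ × ℕ} (hxy : x ≤ y) (hne : x ≠ y)
    (h : ¬ CellAdj x y) : ∃ z, x ≤ z ∧ z ≤ y ∧ z ≠ x ∧ z ≠ y := by
  obtain ⟨x₁, x₂⟩ := x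
  obtain ⟨y₁, y₂⟩ := y
  simp only [CellAdj, abs_eq_max_neg, Prod.mk_le_mk, ne_eq, Prod.mk.injEq] at *
  by_cases h₁ : x₁ < y₁
  · exact ⟨(x₁ + 1, x₂), by simp only [Prod.mk_le_mk, Prod.mk.injEq]; omega⟩
  · exact ⟨(x₁, x₂ + 1), by simp only [Prod.mk_le_mk, Prod.mk.injEq]; omega⟩

/-- The condition on a unit square of a growth diagram with corners `μ`, `ν`, `ρ`, `κ`, where
`μ` is the smallest and `κ` the largest diagram, given the side `μ`, `ν`, `κ`. -/
def IsGrowthSquare (μ ν ρ κ : YoungDiagram) : Prop :=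
  AddBox μ ρ ∧ AddBox ρ κ ∧
    ((∃ c₁ ∈ κ.cells \ μ.cells, ∃ c₂ ∈ κ.cells \ μ.cells, c₁ ≠ c₂ ∧ ¬ CellAdj c₁ c₂) → ν ≠ ρ)

theorem existsUnique_isGrowthSquare {μ ν κ : YoungDiagram} (h₁ : AddBox μ ν) (h₂ : AddBox ν κ) :
    ∃! ρ, IsGrowthSquare μ ν ρ κ := by
  obtain ⟨x, hx, hν⟩ := addBox_iff_exists_insert.1 h₁
  obtain ⟨y, hy, hκ⟩ := addBox_iff_exists_insert.1 h₂
  rw [← hν, Finset.mem_insert, not_or] at hy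
  obtain ⟨hyx, hy⟩ := hy
  have hdiff : ∀ z, z ∈ κ.cells \ μ.cells ↔ z = x ∨ z = y := by
    intro z
    rw [← hκ, ← hν]
    simp only [Finset.mem_sdiff, Finset.mem_insert]
    grind
  have hnon : (∃ c₁ ∈ κ.cells \ μ.cells, ∃ c₂ ∈ κ.cells \ μ.cells, c₁ ≠ c₂ ∧ ¬ CellAdj c₁ c₂) ↔
      ¬ CellAdj x y := by
    simp only [hdiff]
    constructor
    · rintro ⟨c₁, rfl | rfl, c₂, rfl | rfl, hne, h⟩
      · exact absurd rfl hne
      · exact h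
      · exact fun h' => h h'.symm
      · exact absurd rfl hne
    · exact fun h => ⟨x, .inl rfl, y, .inr rfl, Ne.symm hyx, h⟩
  have hmid : ∀ ρ, AddBox μ ρ → AddBox ρ κ →
      ρ = ν ∨ ρ.cells = insert y μ.cells := by
    intro ρ hμρ hρκ
    obtain ⟨z, hz, hρ⟩ := addBox_iff_exists_insert.1 hμρ
    have hzκ : z ∈ κ.cells := hρκ.1 (by rw [← YoungDiagram.mem_cells, ← hρ]; simp)
    rcases (hdiff z).1 (Finset.mem_sdiff.2 ⟨hzκ, hz⟩) with rfl | rfl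
    · exact .inl (YoungDiagram.ext (hρ.symm.trans hν))
    · exact .inr hρ.symm
  unfold IsGrowthSquare
  simp only [hnon]
  by_cases hadj : CellAdj x y
  · refine ⟨ν, ⟨h₁, h₂, fun h => absurd hadj h⟩, ?_⟩
    rintro ρ ⟨hμρ, hρκ, -⟩
    refine (hmid ρ hμρ hρκ).resolve_right fun hρ => ?_
    rcases hadj.le_or_le with hxy | hyx'
    · have : x ∈ ρ.cells := ρ.isLowerSet hxy (by simp [hρ])
      rw [hρ, Finset.mem_insert] at this
      exact this.elim (Ne.symm hyx) hx
    · have : y ∈ ν.cells := ν.isLowerSet hyx' (by simp [← hν])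
      rw [← hν, Finset.mem_insert] at this
      exact this.elim hyx hy
  · have hlower : IsLowerSet (↑(insert y μ.cells) : Set (ℕ × ℕ)) := by
      intro u v hvu hu
      rw [Finset.mem_coe, Finset.mem_insert] at hu ⊢
      rcases hu with rfl | hu
      · have hv : v ∈ κ.cells := κ.isLowerSet hvu (by simp [← hκ])
        rw [← hκ, ← hν, Finset.mem_insert, Finset.mem_insert] at hv
        rcases hv with hv | rfl | hv
        · exact .inl hv
        · obtain ⟨w, hvw, hwu, hwv, hwu'⟩ :=
            exists_between_of_not_cellAdj hvu (Ne.symm hyx) hadj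
          have hw : w ∈ κ.cells := κ.isLowerSet hwu (by simp [← hκ])
          rw [← hκ, ← hν, Finset.mem_insert, Finset.mem_insert] at hw
          exact absurd (μ.isLowerSet hvw ((hw.resolve_left hwu').resolve_left hwv)) hx
        · exact .inr hv
      · exact .inr (μ.isLowerSet hvu hu)
    refine ⟨⟨insert y μ.cells, hlower⟩, ⟨addBox_iff_exists_insert.2 ⟨y, hy, rfl⟩,
      addBox_iff_exists_insert.2 ⟨x, by simp [hx, Ne.symm hyx], ?_⟩, ?_⟩, ?_⟩
    · rw [← hκ, ← hν, Finset.insert_comm]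
    · rintro - rfl
      have : x ∈ insert y μ.cells := hν.subset (Finset.mem_insert_self x μ.cells)
      exact (Finset.mem_insert.1 this).elim (Ne.symm hyx) hx
    · rintro ρ ⟨hμρ, hρκ, hne⟩
      exact YoungDiagram.ext ((hmid ρ hμρ hρκ).resolve_left (Ne.symm (hne hadj)))

/-- The fourth corner of the growth square with side `μ`, `ν`, `κ`. -/
noncomputable def growthFlip (μ ν κ : YoungDiagram) : YoungDiagram :=
  Classical.epsilon fun ρ => IsGrowthSquare μ ν ρ κ

theorem isGrowthSquare_growthFlip {μ ν κ : YoungDiagram} (h₁ : AddBox μ ν) (h₂ : AddBox ν κ) :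
    IsGrowthSquare μ ν (growthFlip μ ν κ) κ :=
  Classical.epsilon_spec (existsUnique_isGrowthSquare h₁ h₂).exists

/-- The array with first column `A` and first row `B` obtained by filling in growth squares. -/
noncomputable def growthFill (A B : ℕ → YoungDiagram) : ℕ → ℕ → YoungDiagram
  | 0, m => B m
  | n + 1, 0 => A (n + 1)
  | n + 1, m + 1 =>
    growthFlip (growthFill A B n (m + 1)) (growthFill A B n m) (growthFill A B (n + 1) m)

section growthFill

variable {A B : ℕ → YoungDiagram} {N M : ℕ}

theorem growthFill_zero_right (h₀ : A 0 = B 0) (n : ℕ) : growthFill A B n 0 = A n := by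
  cases n <;> simp [growthFill, h₀]

theorem addBox_growthFill_succ_left (hA : ∀ n < N, AddBox (A n) (A (n + 1))) (h₀ : A 0 = B 0)
    {n : ℕ} (hn : n < N)
    (hrow : ∀ m < M, AddBox (growthFill A B n (m + 1)) (growthFill A B n m)) :
    ∀ m ≤ M, AddBox (growthFill A B n m) (growthFill A B (n + 1) m)
  | 0, _ => by simpa only [growthFill_zero_right h₀] using hA n hn
  | m + 1, hm => by
    rw [growthFill]
    exact (isGrowthSquare_growthFlip (hrow m hm)
      (addBox_growthFill_succ_left hA h₀ hn hrow m (Nat.le_of_succ_le hm))).1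

theorem addBox_growthFill_succ_right (hA : ∀ n < N, AddBox (A n) (A (n + 1)))
    (hB : ∀ m < M, AddBox (B (m + 1)) (B m)) (h₀ : A 0 = B 0) :
    ∀ n ≤ N, ∀ m < M, AddBox (growthFill A B n (m + 1)) (growthFill A B n m)
  | 0, _, m, hm => by simpa only [growthFill] using hB m hm
  | n + 1, hn, m, hm => by
    have hrow := addBox_growthFill_succ_right hA hB h₀ n (Nat.le_of_succ_le hn)
    rw [growthFill]
    exact (isGrowthSquare_growthFlip (hrow m hm)
      (addBox_growthFill_succ_left hA h₀ hn hrow m hm.le)).2.1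

theorem isGrowthSquare_growthFill (hA : ∀ n < N, AddBox (A n) (A (n + 1)))
    (hB : ∀ m < M, AddBox (B (m + 1)) (B m)) (h₀ : A 0 = B 0) {n m : ℕ} (hn : n < N)
    (hm : m < M) :
    IsGrowthSquare (growthFill A B n (m + 1)) (growthFill A B n m)
      (growthFill A B (n + 1) (m + 1)) (growthFill A B (n + 1) m) := by
  have hrow := addBox_growthFill_succ_right hA hB h₀ n hn.le
  rw [growthFill]
  exact isGrowthSquare_growthFlip (hrow m hm)
    (addBox_growthFill_succ_left hA h₀ hn hrow m hm.le)

end growthFill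

namespace GrowthDiagram

variable {a b c e : ℤ}

theorem γ_injective : Function.Injective (γ : GrowthDiagram a b c e → ℤ → ℤ → YoungDiagram) := by
  rintro ⟨γ, _, _, _, _⟩ ⟨γ', _, _, _, _⟩ rfl
  rfl

theorem isGrowthSquare (g : GrowthDiagram a b c e) {i j : ℤ} (hi : a ≤ i - 1) (hi' : i ≤ b)
    (hj : c ≤ j) (hj' : j + 1 ≤ e) :
    IsGrowthSquare (g.γ i j) (g.γ i (j + 1)) (g.γ (i - 1) j) (g.γ (i - 1) (j + 1)) :=
  ⟨g.grow_up i j hi hi' hj (by lia), g.grow_right (i - 1) j hi (by lia) hj hj',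
    g.nonadj i j hi hi' hj hj'⟩

theorem ext_of_boundary {g g' : GrowthDiagram a b c e}
    (hβ : ∀ j, c ≤ j → j ≤ e → g.γ b j = g'.γ b j)
    (hα : ∀ i, a ≤ i → i ≤ b → g.γ i e = g'.γ i e) : g = g' := by
  have key : ∀ n m : ℕ, a ≤ b - n → c ≤ e - m →
      g.γ (b - n) (e - m) = g'.γ (b - n) (e - m) := by
    intro n
    induction n with
    | zero => exact fun m _ hm => by simpa using hβ (e - m) hm (by lia)
    | succ n ihn =>
      intro m
      induction m with
      | zero => exact fun hn _ => by simpa using hα (b - (n + 1 : ℕ)) hn (by lia)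
      | succ m ihm =>
        intro hn hm
        have hi : b - ((n + 1 : ℕ) : ℤ) = b - n - 1 := by push_cast; ring
        have hj : e - (m : ℤ) = e - ((m + 1 : ℕ) : ℤ) + 1 := by push_cast; ring
        have h₁ := ihn (m + 1) (by lia) hm
        have h₂ := ihn m (by lia) (by lia)
        have h₃ := ihm hn (by lia)
        rw [hi, hj] at h₃
        rw [hj] at h₂
        rw [hi]
        have sq := g.isGrowthSquare (i := b - n) (j := e - (m + 1 : ℕ)) (by lia) (by lia) hm
          (by lia)
        rw [h₁, h₂, h₃] at sq
        exact (existsUnique_isGrowthSquare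
          (g'.grow_right _ _ (by lia) (by lia) hm (by lia))
          (g'.grow_up _ _ (by lia) (by lia) (by lia) (by lia))).unique sq
          (g'.isGrowthSquare (by lia) (by lia) hm (by lia))
  apply γ_injective
  funext i j
  by_cases h : a ≤ i ∧ i ≤ b ∧ c ≤ j ∧ j ≤ e
  · obtain ⟨n, hn⟩ := Int.eq_ofNat_of_zero_le (sub_nonneg.2 h.2.1)
    obtain ⟨m, hm⟩ := Int.eq_ofNat_of_zero_le (sub_nonneg.2 h.2.2.2)
    obtain rfl : i = b - n := by lia
    obtain rfl : j = e - m := by lia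
    exact key n m h.1 h.2.2.1
  · rw [g.junk i j h, g'.junk i j h]

end GrowthDiagram

/-- **Existence and uniqueness of growth diagrams with given right column and top
row.** Let `a ≤ b`, `c ≤ e`. Given chains `β j` (`c ≤ j ≤ e`) with `β (j+1)`
obtained from `β j` by adding one box, and `α i` (`a ≤ i ≤ b`) with `α (i−1)`
obtained from `α i` by adding one box, and `α b = β e`, there is exactly one
growth diagram on `[a,b] × [c,e]` with `γ b j = β j` and `γ i e = α i`. -/
theorem stmt10 (a b c e : ℤ) (hab : a ≤ b) (hce : c ≤ e)
    (β : ℤ → YoungDiagram) (α : ℤ → YoungDiagram)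
    (hβ : ∀ j : ℤ, c ≤ j → j + 1 ≤ e → AddBox (β j) (β (j + 1)))
    (hα : ∀ i : ℤ, a ≤ i - 1 → i ≤ b → AddBox (α i) (α (i - 1)))
    (hcompat : α b = β e) :
    ∃! g : GrowthDiagram a b c e,
      (∀ j : ℤ, c ≤ j → j ≤ e → g.γ b j = β j) ∧
      (∀ i : ℤ, a ≤ i → i ≤ b → g.γ i e = α i) := by
  set F := growthFill (fun n => α (b - n)) (fun m => β (e - m)) with hF
  have hA : ∀ n < (b - a).toNat, AddBox (α (b - (n : ℕ))) (α (b - (n + 1 : ℕ))) := by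
    intro n hn
    have := hα (b - n) (by lia) (by lia)
    rwa [show b - (n : ℤ) - 1 = b - (n + 1 : ℕ) by push_cast; ring] at this
  have hB : ∀ m < (e - c).toNat, AddBox (β (e - (m + 1 : ℕ))) (β (e - (m : ℕ))) := by
    intro m hm
    have := hβ (e - (m + 1 : ℕ)) (by lia) (by lia)
    rwa [show e - ((m + 1 : ℕ) : ℤ) + 1 = e - m by push_cast; ring] at this
  have h₀ : α (b - (0 : ℕ)) = β (e - (0 : ℕ)) := by simpa using hcompat
  have hrow := addBox_growthFill_succ_right (A := fun n => α (b - n)) (B := fun m => β (e - m))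
    hA hB h₀
  have hcol := fun n (hn : n < (b - a).toNat) =>
    addBox_growthFill_succ_left (A := fun n => α (b - n)) (B := fun m => β (e - m))
      hA h₀ hn (hrow n hn.le)
  let γ : ℤ → ℤ → YoungDiagram := fun i j =>
    if a ≤ i ∧ i ≤ b ∧ c ≤ j ∧ j ≤ e then F (b - i).toNat (e - j).toNat else ⊥
  have hγ : ∀ i j, a ≤ i → i ≤ b → c ≤ j → j ≤ e → γ i j = F (b - i).toNat (e - j).toNat :=
    fun i j h₁ h₂ h₃ h₄ => if_pos ⟨h₁, h₂, h₃, h₄⟩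
  have hi : ∀ i, i ≤ b → (b - (i - 1)).toNat = (b - i).toNat + 1 := by lia
  have hj : ∀ j, j + 1 ≤ e → (e - j).toNat = (e - (j + 1)).toNat + 1 := by lia
  have hγβ : ∀ j, c ≤ j → j ≤ e → γ b j = β j := fun j h₁ h₂ => by
    rw [hγ _ _ hab le_rfl h₁ h₂, sub_self, hF, Int.toNat_zero, growthFill]
    congr 1
    lia
  have hγα : ∀ i, a ≤ i → i ≤ b → γ i e = α i := fun i h₁ h₂ => by
    rw [hγ _ _ h₁ h₂ hce le_rfl, sub_self, hF, Int.toNat_zero, growthFill_zero_right h₀]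
    congr 1
    lia
  refine ⟨⟨γ, fun i j h => if_neg h, fun i j _ _ _ h => ?_, fun i j _ h _ _ => ?_,
    fun i j _ h _ h' => ?_⟩, ⟨hγβ, hγα⟩, ?_⟩
  · rw [hγ _ _ (by lia) (by lia) (by lia) (by lia), hγ _ _ (by lia) (by lia) (by lia) (by lia),
      hj j h]
    exact hrow _ (by lia) _ (by lia)
  · rw [hγ _ _ (by lia) (by lia) (by lia) (by lia), hγ _ _ (by lia) (by lia) (by lia) (by lia),
      hi i h]
    exact hcol _ (by lia) _ (by lia)
  · rw [hγ i j (by lia) (by lia) (by lia) (by lia),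
      hγ i (j + 1) (by lia) (by lia) (by lia) (by lia),
      hγ (i - 1) j (by lia) (by lia) (by lia) (by lia),
      hγ (i - 1) (j + 1) (by lia) (by lia) (by lia) (by lia), hi i h, hj j h']
    exact (isGrowthSquare_growthFill (A := fun n => α (b - n)) (B := fun m => β (e - m))
      hA hB h₀ (by lia) (by lia)).2.2
  · rintro g ⟨hgβ, hgα⟩
    exact GrowthDiagram.ext_of_boundary (fun j h₁ h₂ => (hgβ j h₁ h₂).trans (hγβ j h₁ h₂).symm)
      fun i h₁ h₂ => (hgα i h₁ h₂).trans (hγα i h₁ h₂).symm
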